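/- arXiv:1106.1393 — 3 statements merged into one kernel-verified Lean document; each statement's English description precedes it below -/
import Mathlib

section
/- Let X be a complex Hilbert space. For each j ∈ ℕ let T_j be a densely defined symmetric linear operator in X, and let T be a densely defined symmetric linear operator in X. Assume there exist bounded linear operators R_j⁺, R_j⁻ (j ∈ ℕ) and R⁺, R⁻ on X such that for every x ∈ X: R_j^± x lies in the domain of T_j and T_j(R_j^± x) ∓ i·(R_j^± x) = x, and R^± x lies in the domain of T and T(R^± x) ∓ i·(R^± x) = x (so the T_j and T are self-adjoint and R_j^±, R^± are their resolvents at ±i); and assume that for every x ∈ X, R_j^± x → R^± x in norm as j → ∞ (strong resolvent convergence of T_j to T). Suppose that for each j there are E_j ∈ ℝ and φ_j in the domain of T_j with ‖φ_j‖ = 1 and T_j φ_j = E_j · φ_j, and that φ_j converges weakly to some φ ≠ 0. Then the limit E := lim_{j→∞} E_j exists in ℝ, φ lies in the domain of T, and Tφ = E·φ. If, in addition, for every j and every ψ in the domain of T_j one has Re⟨T_j ψ, ψ⟩ ≥ E_j‖ψ‖², then Re⟨Tψ, ψ⟩ ≥ E‖ψ‖² for every ψ in the domain of T (so that T is semi-bounded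 below with greatest lower bound of its quadratic form equal to the eigenvalue E). -/
open scoped ComplexInnerProductSpace

open Filter Topology

namespace LinearPMap

variable {X : Type*} [NormedAddCommGroup X] [InnerProductSpace ℂ X] {S : X →ₗ.[ℂ] X}

/-- A symmetric operator has no eigenvector with non-real eigenvalue. -/
theorem coe_eq_zero_of_apply_eq_smul
    (hS : ∀ ψ φ : S.domain, ⟪S ψ, (φ : X)⟫ = ⟪(ψ : X), S φ⟫)
    {c : ℂ} (hc : c.im ≠ 0) {z : S.domain} (hz : S z = c • (z : X)) : (z : X) = 0 := by
  have h := hS z z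
  rw [hz, inner_smul_left, inner_smul_right] at h
  by_contra hne
  have hconj := mul_right_cancel₀ (inner_self_ne_zero.mpr hne) h
  exact hc (Complex.conj_eq_iff_im.mp hconj)

/-- For a symmetric operator `S` and non-real `c`, the map `S - c` is injective. -/
theorem coe_eq_of_apply_sub_smul_eq
    (hS : ∀ ψ φ : S.domain, ⟪S ψ, (φ : X)⟫ = ⟪(ψ : X), S φ⟫)
    {c : ℂ} (hc : c.im ≠ 0) {ψ φ : S.domain}
    (h : S ψ - c • (ψ : X) = S φ - c • (φ : X)) : (ψ : X) = φ := by
  rw [← sub_eq_zero, ← Submodule.coe_sub]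
  refine coe_eq_zero_of_apply_eq_smul hS hc ?_
  rw [map_sub, Submodule.coe_sub, smul_sub, sub_eq_sub_iff_sub_eq_sub]
  exact h

/-- A vector which is weakly an eigenvector of a symmetric operator `S` with `S ± i` surjective
lies in the domain of `S` and is an eigenvector. -/
theorem exists_mem_domain_apply_eq_smul
    (hS : ∀ ψ φ : S.domain, ⟪S ψ, (φ : X)⟫ = ⟪(ψ : X), S φ⟫)
    (hp : ∀ x, ∃ ψ : S.domain, S ψ - Complex.I • (ψ : X) = x)
    (hm : ∀ x, ∃ ψ : S.domain, S ψ + Complex.I • (ψ : X) = x)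
    {c : ℂ} {φ : X} (h : ∀ ψ : S.domain, ⟪S ψ, φ⟫ = c * ⟪(ψ : X), φ⟫) :
    ∃ hφ : φ ∈ S.domain, S ⟨φ, hφ⟩ = c • φ := by
  obtain ⟨η, hη⟩ := hp ((c - Complex.I) • φ)
  have hηφ : (η : X) = φ := by
    refine ext_inner_left ℂ fun x => ?_
    obtain ⟨ψ, rfl⟩ := hm x
    have hinner := congrArg (fun y => ⟪(ψ : X), y⟫) hη
    simp only [inner_sub_right, inner_smul_right] at hinner
    simp only [inner_add_left, inner_smul_left, Complex.conj_I, h, hS]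
    linear_combination hinner
  subst hηφ
  exact ⟨η.2, by simpa [sub_smul] using hη⟩

end LinearPMap

/-- The inner products of a norm convergent sequence with a bounded weakly convergent sequence
converge. -/
theorem tendsto_inner_of_tendsto_of_tendsto_weak
    {X ι : Type*} [NormedAddCommGroup X] [InnerProductSpace ℂ X] {l : Filter ι}
    {u v : ι → X} {a b : X} {C : ℝ} (hu : Tendsto u l (𝓝 a)) (hC : ∀ j, ‖v j‖ ≤ C)
    (hv : ∀ y : X, Tendsto (fun j => ⟪y, v j⟫) l (𝓝 ⟪y, b⟫)) :
    Tendsto (fun j => ⟪u j, v j⟫) l (𝓝 ⟪a, b⟫) := by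
  have hdiff : Tendsto (fun j => ⟪u j - a, v j⟫) l (𝓝 0) := by
    have hlim : Tendsto (fun j => ‖u j - a‖ * C) l (𝓝 0) := by
      simpa using (tendsto_iff_norm_sub_tendsto_zero.mp hu).mul_const C
    refine squeeze_zero_norm (fun j => (norm_inner_le_norm _ _).trans ?_) hlim
    exact mul_le_mul_of_nonneg_left (hC j) (norm_nonneg _)
  simpa [inner_sub_left] using hdiff.add (hv a)

/-- Abstract lemma on convergence of ground states under strong resolvent convergence
(Lemma 5.1 in the paper). -/
theorem ground_state_limit_of_strong_resolvent_convergence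
    {X : Type*} [NormedAddCommGroup X] [InnerProductSpace ℂ X] [CompleteSpace X]
    (T : ℕ → X →ₗ.[ℂ] X) (T' : X →ₗ.[ℂ] X)
    (hdense : ∀ j, Dense ((T j).domain : Set X))
    (hdense' : Dense (T'.domain : Set X))
    (hsym : ∀ j, ∀ ψ φ : (T j).domain, ⟪(T j) ψ, (φ : X)⟫ = ⟪(ψ : X), (T j) φ⟫)
    (hsym' : ∀ ψ φ : T'.domain, ⟪T' ψ, (φ : X)⟫ = ⟪(ψ : X), T' φ⟫)
    (Rp Rm : ℕ → X →L[ℂ] X) (Rp' Rm' : X →L[ℂ] X)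
    (hRp : ∀ j x, ∃ hx : Rp j x ∈ (T j).domain,
      (T j) ⟨Rp j x, hx⟩ - Complex.I • Rp j x = x)
    (hRm : ∀ j x, ∃ hx : Rm j x ∈ (T j).domain,
      (T j) ⟨Rm j x, hx⟩ + Complex.I • Rm j x = x)
    (hRp' : ∀ x, ∃ hx : Rp' x ∈ T'.domain,
      T' ⟨Rp' x, hx⟩ - Complex.I • Rp' x = x)
    (hRm' : ∀ x, ∃ hx : Rm' x ∈ T'.domain,
      T' ⟨Rm' x, hx⟩ + Complex.I • Rm' x = x)
    (hconvp : ∀ x, Filter.Tendsto (fun j => Rp j x) Filter.atTop (nhds (Rp' x)))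
    (hconvm : ∀ x, Filter.Tendsto (fun j => Rm j x) Filter.atTop (nhds (Rm' x)))
    (E : ℕ → ℝ) (φj : ℕ → X) (hmem : ∀ j, φj j ∈ (T j).domain)
    (hnorm : ∀ j, ‖φj j‖ = 1)
    (heig : ∀ j, (T j) ⟨φj j, hmem j⟩ = (E j : ℂ) • φj j)
    (φ : X) (hφ : φ ≠ 0)
    (hweak : ∀ y : X,
      Filter.Tendsto (fun j => ⟪y, φj j⟫) Filter.atTop (nhds ⟪y, φ⟫)) :
    ∃ E' : ℝ, Filter.Tendsto E Filter.atTop (nhds E') ∧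
      ∃ hφmem : φ ∈ T'.domain, T' ⟨φ, hφmem⟩ = (E' : ℂ) • φ ∧
        ((∀ j, ∀ ψ : (T j).domain, E j * ‖(ψ : X)‖ ^ 2 ≤ (⟪(T j) ψ, (ψ : X)⟫).re) →
          ∀ ψ : T'.domain, E' * ‖(ψ : X)‖ ^ 2 ≤ (⟪T' ψ, (ψ : X)⟫).re) := by
  have key : ∀ ψ : T'.domain, Tendsto (fun j => ⟪Rm j (T' ψ + Complex.I • (ψ : X)), φj j⟫)
      atTop (𝓝 ⟪(ψ : X), φ⟫) := by
    intro ψ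
    refine tendsto_inner_of_tendsto_of_tendsto_weak ?_ (fun j => (hnorm j).le) hweak
    obtain ⟨hx, hR⟩ := hRm' (T' ψ + Complex.I • (ψ : X))
    have heq : Rm' (T' ψ + Complex.I • (ψ : X)) = ψ :=
      LinearPMap.coe_eq_of_apply_sub_smul_eq hsym' (c := -Complex.I) (by simp)
        (ψ := ⟨_, hx⟩) (by simpa only [neg_smul, sub_neg_eq_add] using hR)
    have hlim := hconvm (T' ψ + Complex.I • (ψ : X))
    rwa [heq] at hlim
  have hres : ∀ j x, ⟪x, φj j⟫ = ((E j : ℂ) - Complex.I) * ⟪Rm j x, φj j⟫ := by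
    intro j x
    obtain ⟨hx, hR⟩ := hRm j x
    have hs := hsym j ⟨_, hx⟩ ⟨_, hmem j⟩
    rw [heig, inner_smul_right] at hs
    calc ⟪x, φj j⟫ = ⟪T j ⟨Rm j x, hx⟩ + Complex.I • Rm j x, φj j⟫ := by rw [hR]
      _ = _ := by
        rw [inner_add_left, inner_smul_left, hs, Complex.conj_I]
        ring
  obtain ⟨ψ₀, hψ₀⟩ : ∃ ψ : T'.domain, ⟪(ψ : X), φ⟫ ≠ 0 := by
    by_contra! h
    exact hφ (hdense'.eq_zero_of_inner_right ℂ fun v hv => h ⟨v, hv⟩)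
  obtain ⟨E', hE'⟩ : ∃ E' : ℝ, Tendsto E atTop (𝓝 E') := by
    have hquot := (hweak (T' ψ₀ + Complex.I • (ψ₀ : X))).div (key ψ₀) hψ₀
    refine ⟨_, ((Complex.continuous_re.tendsto _).comp hquot).congr' ?_⟩
    filter_upwards [(key ψ₀).eventually_ne hψ₀] with j hj
    simp only [Function.comp_apply, Pi.div_apply]
    rw [hres, mul_div_cancel_right₀ _ hj]
    simp
  have hE'c : Tendsto (fun j => (E j : ℂ)) atTop (𝓝 (E' : ℂ)) :=
    (Complex.continuous_ofReal.tendsto _).comp hE'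
  have hadj : ∀ ψ : T'.domain, ⟪T' ψ, φ⟫ = (E' : ℂ) * ⟪(ψ : X), φ⟫ := by
    intro ψ
    have hlim := (hE'c.sub_const Complex.I).mul (key ψ)
    simp only [← hres] at hlim
    have heq := tendsto_nhds_unique (hweak _) hlim
    rw [inner_add_left, inner_smul_left, Complex.conj_I] at heq
    linear_combination heq
  obtain ⟨hφmem, hTφ⟩ := LinearPMap.exists_mem_domain_apply_eq_smul hsym'
    (fun x => (hRp' x).elim fun hx h => ⟨⟨_, hx⟩, h⟩)
    (fun x => (hRm' x).elim fun hx h => ⟨⟨_, hx⟩, h⟩) hadj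
  refine ⟨E', hE', hφmem, hTφ, fun hbound ψ => ?_⟩
  set x := T' ψ - Complex.I • (ψ : X) with hx_def
  obtain ⟨hx, hR⟩ := hRp' x
  have heq : Rp' x = ψ :=
    LinearPMap.coe_eq_of_apply_sub_smul_eq hsym' (c := Complex.I) (by simp) (ψ := ⟨_, hx⟩) hR
  have hlim : Tendsto (fun j => Rp j x) atTop (𝓝 (ψ : X)) := heq ▸ hconvp x
  have hlimT : Tendsto (fun j => x + Complex.I • Rp j x) atTop (𝓝 (T' ψ)) := by
    simpa [hx_def] using (hlim.const_smul Complex.I).const_add x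
  refine le_of_tendsto_of_tendsto' (hE'.mul (hlim.norm.pow 2))
    ((Complex.continuous_re.tendsto _).comp (hlimT.inner hlim)) fun j => ?_
  obtain ⟨hxj, hRj⟩ := hRp j x
  have hb := hbound j ⟨_, hxj⟩
  rwa [sub_eq_iff_eq_add.mp hRj] at hb
end

section
/- Let A be a unital C*-algebra over ℂ and let a ∈ A be self-adjoint and invertible. Then for every y ∈ ℝ the element a − (iy)·1 is invertible, and the principal value (1/π)·∫_{−τ}^{τ} (a − (iy)·1)⁻¹ dy converges in norm, as τ → ∞, to a·(√(a²))⁻¹, i.e., to the sign a·|a|⁻¹ of a, where |a| := √(a*a) = √(a²). -/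
open MeasureTheory

theorem Real.abs_arctan_le (x : ℝ) : |Real.arctan x| ≤ |x| := by
  wlog hx : 0 ≤ x generalizing x
  · simpa [Real.arctan_neg] using this (-x) (by linarith)
  have h : 0 ≤ Real.arctan x := Real.arctan_nonneg.2 hx
  rw [abs_of_nonneg h, abs_of_nonneg hx]
  simpa [Real.tan_arctan] using Real.le_tan h (Real.arctan_lt_pi_div_two x)

theorem ofReal_sub_mul_I_ne_zero {x : ℝ} (hx : x ≠ 0) (y : ℝ) :
    (x : ℂ) - (y : ℂ) * Complex.I ≠ 0 := fun h => hx <| by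
  simpa using congrArg Complex.re h

/-- The principal-value integral of the resolvent of a nonzero real number. -/
theorem intervalIntegral_inv_ofReal_sub_mul_I {x : ℝ} (hx : x ≠ 0) (τ : ℝ) :
    ∫ y in (-τ)..τ, ((x : ℂ) - (y : ℂ) * Complex.I)⁻¹ = ((2 * Real.arctan (τ / x) : ℝ) : ℂ) := by
  have hpos : ∀ y : ℝ, 0 < x ^ 2 + y ^ 2 := fun y => by positivity
  have hderiv : ∀ y ∈ Set.uIcc (-τ) τ, HasDerivAt
      (fun y : ℝ => ((Real.arctan (y / x) : ℝ) : ℂ)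
        + ((Real.log (x ^ 2 + y ^ 2) / 2 : ℝ) : ℂ) * Complex.I)
      (((x : ℂ) - (y : ℂ) * Complex.I)⁻¹) y := by
    intro y _
    have h₁ : HasDerivAt (fun y : ℝ => Real.arctan (y / x)) (x / (x ^ 2 + y ^ 2)) y := by
      refine ((hasDerivAt_id' y).div_const x).arctan.congr_deriv ?_
      have := (hpos y).ne'
      field_simp
    have h₂ : HasDerivAt (fun y : ℝ => Real.log (x ^ 2 + y ^ 2) / 2) (y / (x ^ 2 + y ^ 2)) y := by
      refine ((((hasDerivAt_pow 2 y).const_add (x ^ 2)).log (hpos y).ne').div_const 2).congr_deriv ?_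
      have := (hpos y).ne'
      field_simp
      simp [mul_comm]
    refine (h₁.ofReal_comp.add (h₂.ofReal_comp.mul_const Complex.I)).congr_deriv ?_
    have hne : (x : ℂ) ^ 2 + (y : ℂ) ^ 2 ≠ 0 := mod_cast (hpos y).ne'
    refine eq_inv_of_mul_eq_one_left ?_
    push_cast
    field_simp
    linear_combination -(y : ℂ) ^ 2 * Complex.I_sq
  rw [intervalIntegral.integral_eq_sub_of_hasDerivAt hderiv]
  · simp [neg_div, Real.arctan_neg]
    ring
  · apply Continuous.intervalIntegrable
    exact Continuous.inv₀ (by fun_prop) (ofReal_sub_mul_I_ne_zero hx)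

theorem abs_two_mul_arctan_div_sub_pi_mul_sign_le {x τ : ℝ} (hx : x ≠ 0) (hτ : 0 < τ) :
    |2 * Real.arctan (τ / x) - Real.pi * (x * |x|⁻¹)| ≤ 2 * (|x| / τ) := by
  have h : 2 * Real.arctan (τ / x) - Real.pi * (x * |x|⁻¹) = -2 * Real.arctan (x / τ) := by
    rw [← inv_div x τ]
    rcases lt_or_gt_of_ne hx with hx' | hx'
    · rw [Real.arctan_inv_of_neg (div_neg_of_neg_of_pos hx' hτ), abs_of_neg hx']
      field_simp
      ring
    · rw [Real.arctan_inv_of_pos (by positivity), abs_of_pos hx']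
      field_simp
      ring
  rw [h, abs_mul]
  have := Real.abs_arctan_le (x / τ)
  rw [abs_div, abs_of_pos hτ] at this
  simpa using this

theorem CFC.sqrt_mul_self_eq_cfc_norm {A : Type*} [CStarAlgebra A] [PartialOrder A]
    [StarOrderedRing A] (a : A) (ha : IsSelfAdjoint a) :
    CFC.sqrt (a * a) = cfc (fun z : ℂ => (‖z‖ : ℂ)) a := by
  have := CFC.abs_eq_cfcₙ_coe_norm ℂ a ha.isStarNormal
  rwa [CFC.abs, ha.star_eq, cfcₙ_eq_cfc] at this

section CStarAlgebra

variable {A : Type*} [CStarAlgebra A] {a : A}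

theorem IsSelfAdjoint.re_ne_zero_of_mem_spectrum (ha : IsSelfAdjoint a) (hinv : IsUnit a)
    {z : ℂ} (hz : z ∈ spectrum ℂ a) : z.re ≠ 0 := by
  intro h
  rw [ha.mem_spectrum_eq_re hz, h, Complex.ofReal_zero] at hz
  exact spectrum.zero_notMem ℂ hinv hz

theorem IsSelfAdjoint.sub_mul_I_ne_zero_of_mem_spectrum (ha : IsSelfAdjoint a) (hinv : IsUnit a)
    {z : ℂ} (hz : z ∈ spectrum ℂ a) (y : ℝ) : z - (y : ℂ) * Complex.I ≠ 0 := by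
  rw [ha.mem_spectrum_eq_re hz]
  exact ofReal_sub_mul_I_ne_zero (ha.re_ne_zero_of_mem_spectrum hinv hz) y

theorem cfc_sub_const_eq (ha : IsSelfAdjoint a) (c : ℂ) :
    cfc (fun z : ℂ => z - c) a = a - c • (1 : A) := by
  have := ha.isStarNormal
  rw [cfc_sub (fun z : ℂ => z) (fun _ => c) a, cfc_id' ℂ a, cfc_const c a,
    Algebra.algebraMap_eq_smul_one]

/-- The truncated integral of the resolvent along the imaginary axis is `2 arctan (τ / a)`. -/
theorem intervalIntegral_inverse_sub_mul_I_eq_cfc (ha : IsSelfAdjoint a) (hinv : IsUnit a)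
    {τ : ℝ} (hτ : 0 ≤ τ) :
    ∫ y in (-τ)..τ, Ring.inverse (a - ((y : ℂ) * Complex.I) • (1 : A)) =
      cfc (fun z : ℂ => ((2 * Real.arctan (τ / z.re) : ℝ) : ℂ)) a := by
  have hnormal := ha.isStarNormal
  have hne := fun (z : ℂ) (hz : z ∈ spectrum ℂ a) =>
    ha.sub_mul_I_ne_zero_of_mem_spectrum hinv hz
  have hcont : ContinuousOn (Function.uncurry fun (y : ℝ) (z : ℂ) =>
      (z - (y : ℂ) * Complex.I)⁻¹) (Set.univ ×ˢ spectrum ℂ a) :=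
    ContinuousOn.inv₀ (by fun_prop) fun p hp => hne p.2 hp.2 p.1
  obtain ⟨C, hC⟩ := (isCompact_Icc.prod (spectrum.isCompact a)).exists_bound_of_continuousOn
    (hcont.mono (Set.prod_mono_left (Set.subset_univ (Set.Icc (-τ) τ))))
  have hle : -τ ≤ τ := by linarith
  calc
    _ = ∫ y in Set.Ioc (-τ) τ, cfc (fun z : ℂ => (z - (y : ℂ) * Complex.I)⁻¹) a := by
      rw [intervalIntegral.integral_of_le hle]
      congr 1 with y
      rw [cfc_inv (fun z : ℂ => z - (y : ℂ) * Complex.I) a fun z hz => hne z hz y,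
        cfc_sub_const_eq ha]
    _ = cfc (fun z : ℂ => ∫ y in Set.Ioc (-τ) τ, (z - (y : ℂ) * Complex.I)⁻¹) a := by
      refine (cfc_setIntegral measurableSet_Ioc (fun (y : ℝ) (z : ℂ) =>
        (z - (y : ℂ) * Complex.I)⁻¹) (fun _ => C) a
        (hcont.mono (Set.prod_mono_left (Set.subset_univ _))) ?_ ?_).symm
      · exact ae_restrict_of_forall_mem measurableSet_Ioc fun y hy z hz =>
          hC (y, z) ⟨Set.Ioc_subset_Icc_self hy, hz⟩
      · exact (integrable_const C).hasFiniteIntegral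
    _ = _ := by
      refine cfc_congr fun z hz => ?_
      have hz' := ha.mem_spectrum_eq_re hz
      rw [← intervalIntegral_inv_ofReal_sub_mul_I (ha.re_ne_zero_of_mem_spectrum hinv hz),
        intervalIntegral.integral_of_le hle, ← hz']

theorem mul_inverse_sqrt_mul_self_eq_cfc [PartialOrder A] [StarOrderedRing A]
    (ha : IsSelfAdjoint a) (hinv : IsUnit a) :
    a * Ring.inverse (CFC.sqrt (a * a)) = cfc (fun z : ℂ => z * (‖z‖ : ℂ)⁻¹) a := by
  have hnormal := ha.isStarNormal
  have hne : ∀ z ∈ spectrum ℂ a, (‖z‖ : ℂ) ≠ 0 := fun z hz => by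
    simpa using spectrum.ne_zero_of_mem_of_unit (a := hinv.unit) hz
  rw [CFC.sqrt_mul_self_eq_cfc_norm a ha, ← cfc_inv _ a hne,
    cfc_mul (fun z : ℂ => z) (fun z => (‖z‖ : ℂ)⁻¹) a (by fun_prop)
      (ContinuousOn.inv₀ (by fun_prop) hne), cfc_id' ℂ a]

theorem norm_intervalIntegral_inverse_sub_sign_le [PartialOrder A] [StarOrderedRing A]
    (ha : IsSelfAdjoint a) (hinv : IsUnit a) {τ : ℝ} (hτ : 0 < τ) :
    ‖(∫ y in (-τ)..τ, Ring.inverse (a - ((y : ℂ) * Complex.I) • (1 : A))) -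
      Real.pi • (a * Ring.inverse (CFC.sqrt (a * a)))‖ ≤ 2 * (‖a‖ * ‖(1 : A)‖ / τ) := by
  have hre := fun (z : ℂ) (hz : z ∈ spectrum ℂ a) => ha.re_ne_zero_of_mem_spectrum hinv hz
  have hsign : ContinuousOn (fun z : ℂ => z * (‖z‖ : ℂ)⁻¹) (spectrum ℂ a) :=
    continuousOn_id.mul <| ContinuousOn.inv₀ (by fun_prop) fun z hz => by
      simpa using spectrum.ne_zero_of_mem_of_unit (a := hinv.unit) hz
  have harctan : ContinuousOn (fun z : ℂ => ((2 * Real.arctan (τ / z.re) : ℝ) : ℂ))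
      (spectrum ℂ a) := by
    refine Complex.continuous_ofReal.comp_continuousOn (continuousOn_const.mul ?_)
    exact Real.continuous_arctan.comp_continuousOn
      (continuousOn_const.div Complex.continuous_re.continuousOn hre)
  rw [intervalIntegral_inverse_sub_mul_I_eq_cfc ha hinv hτ.le,
    mul_inverse_sqrt_mul_self_eq_cfc ha hinv, ← cfc_smul Real.pi _ a hsign,
    ← cfc_sub _ (fun z : ℂ => Real.pi • (z * (‖z‖ : ℂ)⁻¹)) a harctan (hsign.const_smul Real.pi)]
  refine norm_cfc_le (by positivity) fun z hz => ?_
  have hz' := ha.mem_spectrum_eq_re hz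
  have hnorm : |z.re| ≤ ‖a‖ * ‖(1 : A)‖ :=
    (Complex.abs_re_le_norm z).trans (spectrum.norm_le_norm_mul_of_mem hz)
  calc
    _ = |2 * Real.arctan (τ / z.re) - Real.pi * (z.re * |z.re|⁻¹)| := by
      rw [hz', ← Real.norm_eq_abs, ← Complex.norm_real]
      simp
    _ ≤ 2 * (|z.re| / τ) := abs_two_mul_arctan_div_sub_pi_mul_sign_le (hre z hz) hτ
    _ ≤ _ := by gcongr

end CStarAlgebra

/-- For a self-adjoint invertible element `a` of a unital complex C*-algebra, every `a − iy·1`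
(`y ∈ ℝ`) is invertible and the principal value `(1/π) ∫_{−τ}^{τ} (a − iy·1)⁻¹ dy` converges
in norm, as `τ → ∞`, to the sign `a·|a|⁻¹` of `a`, where `|a| = √(a²)`. -/
theorem sign_eq_principal_value_resolvent {A : Type*} [CStarAlgebra A] [PartialOrder A]
    [StarOrderedRing A] (a : A) (ha : IsSelfAdjoint a) (hinv : IsUnit a) :
    (∀ y : ℝ, IsUnit (a - ((y : ℂ) * Complex.I) • (1 : A))) ∧
    Filter.Tendsto
      (fun τ : ℝ =>
        (Real.pi)⁻¹ • ∫ y in (-τ)..τ, Ring.inverse (a - ((y : ℂ) * Complex.I) • (1 : A)))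
      Filter.atTop
      (nhds (a * Ring.inverse (CFC.sqrt (a * a)))) := by
  refine ⟨fun y => ?_, ?_⟩
  · have hnormal := ha.isStarNormal
    rw [← cfc_sub_const_eq ha]
    exact (isUnit_cfc_iff _ a).2 fun z hz => ha.sub_mul_I_ne_zero_of_mem_spectrum hinv hz y
  · have hlim : Filter.Tendsto
        (fun τ : ℝ => ∫ y in (-τ)..τ, Ring.inverse (a - ((y : ℂ) * Complex.I) • (1 : A)))
        Filter.atTop (nhds (Real.pi • (a * Ring.inverse (CFC.sqrt (a * a))))) := by
      rw [tendsto_iff_norm_sub_tendsto_zero]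
      refine squeeze_zero' (.of_forall fun _ => norm_nonneg _)
        ((Filter.eventually_gt_atTop 0).mono fun τ hτ =>
          norm_intervalIntegral_inverse_sub_sign_le ha hinv hτ) ?_
      simpa using (Filter.tendsto_id.const_div_atTop (‖a‖ * ‖(1 : A)‖)).const_mul 2
    simpa [smul_smul, Real.pi_ne_zero] using hlim.const_smul (Real.pi)⁻¹
end

section
/- Fix e ∈ ℝ and Λ > 0. There is a constant C > 0, depending only on e, such that for every x ∈ ℝ³, every λ ∈ {0,1}, and all k, p ∈ ℝ³ with 0 < ‖k‖ < Λ, 0 < ‖p‖ < Λ, k_⊥ ≠ 0 and p_⊥ ≠ 0, one has ‖G̃_x(k,λ) − G̃_x(p,λ)‖ ≤ C·(1+‖x‖)·‖k‖·‖k−p‖·( 1/(‖k‖^{1/2}·‖k_⊥‖) + 1/(‖p‖^{1/2}·‖p_⊥‖) ). -/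
open scoped RealInnerProductSpace

noncomputable section

/-- `k_⊥ = (k⁽²⁾, −k⁽¹⁾, 0)` for `k ∈ ℝ³`. -/
def kperp (k : EuclideanSpace ℝ (Fin 3)) : EuclideanSpace ℝ (Fin 3) :=
  (WithLp.equiv 2 (Fin 3 → ℝ)).symm ![k 1, -k 0, 0]

/-- First polarization vector `ε(k,0) = k_⊥/‖k_⊥‖`. -/
def eps0 (k : EuclideanSpace ℝ (Fin 3)) : EuclideanSpace ℝ (Fin 3) :=
  ‖kperp k‖⁻¹ • kperp k

/-- Second polarization vector `ε(k,1) = (k/‖k‖) × ε(k,0)`. -/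
def eps1 (k : EuclideanSpace ℝ (Fin 3)) : EuclideanSpace ℝ (Fin 3) :=
  (WithLp.equiv 2 (Fin 3 → ℝ)).symm
    (crossProduct (WithLp.equiv 2 (Fin 3 → ℝ) (‖k‖⁻¹ • k)) (WithLp.equiv 2 (Fin 3 → ℝ) (eps0 k)))

/-- The polarization vectors `ε(k,λ)`, `λ ∈ {0,1}`. -/
def eps (k : EuclideanSpace ℝ (Fin 3)) (l : Fin 2) : EuclideanSpace ℝ (Fin 3) :=
  if l = 0 then eps0 k else eps1 k

/-- The coupling function
`G_x(k,λ) = −(e/(2π))·‖k‖^{−1/2}·1_{‖k‖≤Λ}·e^{−i k·x}·ε(k,λ) ∈ ℂ³`. -/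
def Gcoup (e Λ : ℝ) (x k : EuclideanSpace ℝ (Fin 3)) (l : Fin 2) :
    EuclideanSpace ℂ (Fin 3) :=
  (((-(e / (2 * Real.pi)) * (if ‖k‖ ≤ Λ then (1 : ℝ) else 0) * ‖k‖ ^ (-(1 : ℝ) / 2) : ℝ) : ℂ) *
      Complex.exp (-(Complex.I * (⟪k, x⟫ : ℝ)))) •
    (WithLp.equiv 2 (Fin 3 → ℂ)).symm fun i => ((eps k l i : ℝ) : ℂ)

/-- `G̃_x(k,λ) = G_x(k,λ) − G_0(k,λ)`. -/
def Gtilde (e Λ : ℝ) (x k : EuclideanSpace ℝ (Fin 3)) (l : Fin 2) :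
    EuclideanSpace ℂ (Fin 3) :=
  Gcoup e Λ x k l - Gcoup e Λ 0 k l

/-- The componentwise inclusion `ℝ³ → ℂ³`. -/
def complexify (v : EuclideanSpace ℝ (Fin 3)) : EuclideanSpace ℂ (Fin 3) :=
  (WithLp.equiv 2 (Fin 3 → ℂ)).symm fun i => ((v i : ℝ) : ℂ)

lemma norm_complexify (v : EuclideanSpace ℝ (Fin 3)) : ‖complexify v‖ = ‖v‖ := by
  simp [complexify, EuclideanSpace.norm_eq]

lemma complexify_sub (v w : EuclideanSpace ℝ (Fin 3)) :
    complexify (v - w) = complexify v - complexify w := by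
  ext i
  simp [complexify]

/-- The cross product on Euclidean `ℝ³`. -/
def euclideanCross (a b : EuclideanSpace ℝ (Fin 3)) : EuclideanSpace ℝ (Fin 3) :=
  (WithLp.equiv 2 (Fin 3 → ℝ)).symm
    (crossProduct (WithLp.equiv 2 (Fin 3 → ℝ) a) (WithLp.equiv 2 (Fin 3 → ℝ) b))

lemma norm_euclideanCross_le (a b : EuclideanSpace ℝ (Fin 3)) :
    ‖euclideanCross a b‖ ≤ ‖a‖ * ‖b‖ := by
  refine (sq_le_sq₀ (norm_nonneg _) (by positivity)).mp ?_
  rw [mul_pow, EuclideanSpace.real_norm_sq_eq, EuclideanSpace.real_norm_sq_eq,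
    EuclideanSpace.real_norm_sq_eq]
  simp only [euclideanCross, Fin.sum_univ_three, cross_apply, WithLp.equiv_apply,
    WithLp.equiv_symm_apply, Matrix.cons_val]
  nlinarith [sq_nonneg (a 0 * b 0 + a 1 * b 1 + a 2 * b 2)]

lemma euclideanCross_sub_euclideanCross (a b c d : EuclideanSpace ℝ (Fin 3)) :
    euclideanCross a b - euclideanCross c d =
      euclideanCross (a - c) b + euclideanCross c (b - d) := by
  ext i
  simp [euclideanCross]

lemma norm_inv_norm_smul_eq_one {E : Type*} [NormedAddCommGroup E] [NormedSpace ℝ E] {u : E}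
    (hu : u ≠ 0) : ‖‖u‖⁻¹ • u‖ = 1 := by
  rw [norm_smul, norm_inv, norm_norm, inv_mul_cancel₀ (norm_ne_zero_iff.mpr hu)]

lemma norm_inv_norm_smul_sub_le {E : Type*} [NormedAddCommGroup E] [NormedSpace ℝ E] {u v : E}
    (hu : u ≠ 0) (hv : v ≠ 0) :
    ‖‖u‖⁻¹ • u - ‖v‖⁻¹ • v‖ ≤ 2 * ‖u - v‖ / ‖v‖ := by
  have hu' : 0 < ‖u‖ := norm_pos_iff.mpr hu
  have hv' : 0 < ‖v‖ := norm_pos_iff.mpr hv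
  have key : ‖v‖ • (‖u‖⁻¹ • u - ‖v‖⁻¹ • v) = (‖v‖ - ‖u‖) • (‖u‖⁻¹ • u) + (u - v) := by
    rw [smul_sub, sub_smul, smul_inv_smul₀ hu'.ne', smul_inv_smul₀ hv'.ne']
    abel
  rw [le_div_iff₀ hv']
  calc ‖‖u‖⁻¹ • u - ‖v‖⁻¹ • v‖ * ‖v‖
      = ‖(‖v‖ - ‖u‖) • (‖u‖⁻¹ • u) + (u - v)‖ := by
        rw [← key, norm_smul, norm_norm, mul_comm]
    _ ≤ ‖(‖v‖ - ‖u‖) • (‖u‖⁻¹ • u)‖ + ‖u - v‖ := norm_add_le _ _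
    _ = |‖v‖ - ‖u‖| + ‖u - v‖ := by
        rw [norm_smul, norm_inv_norm_smul_eq_one hu, mul_one, Real.norm_eq_abs]
    _ ≤ 2 * ‖u - v‖ := by
        have := abs_norm_sub_norm_le v u
        rw [norm_sub_rev] at this
        linarith

lemma kperp_sub (k p : EuclideanSpace ℝ (Fin 3)) : kperp (k - p) = kperp k - kperp p := by
  ext i
  fin_cases i <;> simp [kperp]; ring

lemma norm_kperp_le (k : EuclideanSpace ℝ (Fin 3)) : ‖kperp k‖ ≤ ‖k‖ := by
  refine (sq_le_sq₀ (norm_nonneg _) (norm_nonneg _)).mp ?_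
  rw [EuclideanSpace.real_norm_sq_eq, EuclideanSpace.real_norm_sq_eq]
  simp only [kperp, Fin.sum_univ_three, WithLp.equiv_symm_apply, Matrix.cons_val]
  nlinarith [sq_nonneg (k 2)]

lemma norm_eps0_sub_le {k p : EuclideanSpace ℝ (Fin 3)} (hk : kperp k ≠ 0) (hp : kperp p ≠ 0) :
    ‖eps0 k - eps0 p‖ ≤ 2 * ‖k - p‖ / ‖kperp p‖ := by
  refine (norm_inv_norm_smul_sub_le hk hp).trans ?_
  rw [← kperp_sub]
  gcongr
  exact norm_kperp_le _

lemma eps1_eq (k : EuclideanSpace ℝ (Fin 3)) :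
    eps1 k = euclideanCross (‖k‖⁻¹ • k) (eps0 k) := rfl

lemma ne_zero_of_kperp_ne_zero {k : EuclideanSpace ℝ (Fin 3)} (hk : kperp k ≠ 0) : k ≠ 0 :=
  norm_pos_iff.mp ((norm_pos_iff.mpr hk).trans_le (norm_kperp_le k))

lemma norm_eps_le_one {k : EuclideanSpace ℝ (Fin 3)} (hk : kperp k ≠ 0) (l : Fin 2) :
    ‖eps k l‖ ≤ 1 := by
  have h0 : ‖eps0 k‖ = 1 := norm_inv_norm_smul_eq_one hk
  rw [eps]
  split_ifs
  · exact h0.le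
  · rw [eps1_eq]
    refine (norm_euclideanCross_le _ _).trans ?_
    rw [h0, norm_inv_norm_smul_eq_one (ne_zero_of_kperp_ne_zero hk), one_mul]

lemma norm_eps_sub_le {k p : EuclideanSpace ℝ (Fin 3)} (hk : kperp k ≠ 0) (hp : kperp p ≠ 0)
    (l : Fin 2) : ‖eps k l - eps p l‖ ≤ 4 * ‖k - p‖ / ‖kperp p‖ := by
  have hp' : 0 < ‖kperp p‖ := norm_pos_iff.mpr hp
  have h0 := norm_eps0_sub_le hk hp
  have hd : 0 ≤ 2 * ‖k - p‖ / ‖kperp p‖ := by positivity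
  have hsplit : 4 * ‖k - p‖ / ‖kperp p‖ =
      2 * ‖k - p‖ / ‖kperp p‖ + 2 * ‖k - p‖ / ‖kperp p‖ := by ring
  rw [eps, eps, hsplit]
  split_ifs
  · linarith
  · have hk0 := ne_zero_of_kperp_ne_zero hk
    have hp0 := ne_zero_of_kperp_ne_zero hp
    have hdir : ‖‖k‖⁻¹ • k - ‖p‖⁻¹ • p‖ ≤ 2 * ‖k - p‖ / ‖kperp p‖ :=
      (norm_inv_norm_smul_sub_le hk0 hp0).trans (by gcongr; exact norm_kperp_le p)
    rw [eps1_eq, eps1_eq, euclideanCross_sub_euclideanCross]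
    refine (norm_add_le _ _).trans (add_le_add ?_ ?_)
    · refine (norm_euclideanCross_le _ _).trans ?_
      rwa [eps0, norm_inv_norm_smul_eq_one hk, mul_one]
    · refine (norm_euclideanCross_le _ _).trans ?_
      rwa [norm_inv_norm_smul_eq_one hp0, one_mul]

/-- The phase factor `e^{−i k·x} − 1`. -/
def phase (x k : EuclideanSpace ℝ (Fin 3)) : ℂ :=
  Complex.exp (-(Complex.I * (⟪k, x⟫ : ℝ))) - 1

lemma norm_phase_sub_le (x k p : EuclideanSpace ℝ (Fin 3)) :
    ‖phase x k - phase x p‖ ≤ ‖x‖ * ‖k - p‖ := by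
  have hfactor : phase x k - phase x p =
      Complex.exp (Complex.I * ((-⟪p, x⟫ : ℝ) : ℂ)) *
        (Complex.exp (Complex.I * ((-⟪k - p, x⟫ : ℝ) : ℂ)) - 1) := by
    rw [mul_sub, ← Complex.exp_add, mul_one, phase, phase, sub_sub_sub_cancel_right,
      inner_sub_left]
    congr 2 <;> push_cast <;> ring
  rw [hfactor, norm_mul, Complex.norm_exp_I_mul_ofReal, one_mul]
  refine (Real.norm_exp_I_mul_ofReal_sub_one_le).trans ?_
  rw [norm_neg, mul_comm]
  exact norm_inner_le_norm _ _

lemma norm_phase_le (x k : EuclideanSpace ℝ (Fin 3)) : ‖phase x k‖ ≤ ‖x‖ * ‖k‖ := by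
  have h := norm_phase_sub_le x k 0
  have h0 : phase x 0 = 0 := by simp [phase]
  rwa [h0, sub_zero, sub_zero] at h

lemma Gtilde_eq {e Λ : ℝ} {k : EuclideanSpace ℝ (Fin 3)} (hk : ‖k‖ ≤ Λ)
    (x : EuclideanSpace ℝ (Fin 3)) (l : Fin 2) :
    Gtilde e Λ x k l = ((-(e / (2 * Real.pi)) : ℝ) : ℂ) •
      ((((Real.sqrt ‖k‖)⁻¹ : ℝ) : ℂ) * phase x k) • complexify (eps k l) := by
  have hpow : ‖k‖ ^ (-(1 : ℝ) / 2) = (Real.sqrt ‖k‖)⁻¹ := by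
    rw [neg_div, Real.rpow_neg (norm_nonneg k), Real.sqrt_eq_rpow]
  rw [Gtilde, Gcoup, Gcoup, if_pos hk, hpow, ← complexify, ← sub_smul, smul_smul, phase,
    inner_zero_right]
  congr 1
  push_cast
  simp only [mul_zero, neg_zero, Complex.exp_zero]
  ring

lemma abs_inv_sub_inv_le {a b : ℝ} (ha : 0 < a) (hb : 0 < b) :
    |a⁻¹ - b⁻¹| ≤ |a ^ 2 - b ^ 2| * ((a ^ 3)⁻¹ + (b ^ 3)⁻¹) := by
  have hab : a⁻¹ - b⁻¹ = -((a ^ 2 - b ^ 2) * (a * b * (a + b))⁻¹) := by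
    field_simp
    ring
  rw [hab, abs_neg, abs_mul, abs_of_pos (by positivity : 0 < (a * b * (a + b))⁻¹)]
  gcongr
  rcases le_total a b with h | h
  · have : (a * b * (a + b))⁻¹ ≤ (a ^ 3)⁻¹ := by
      gcongr
      calc a ^ 3 = a * a * a := by ring
        _ ≤ a * b * (a + b) := by gcongr; linarith
    have : 0 < (b ^ 3)⁻¹ := by positivity
    linarith
  · have : (a * b * (a + b))⁻¹ ≤ (b ^ 3)⁻¹ := by
      gcongr
      calc b ^ 3 = b * b * b := by ring
        _ ≤ a * b * (a + b) := by gcongr; linarith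
    have : 0 < (a ^ 3)⁻¹ := by positivity
    linarith

lemma inv_le_sq_mul_add {a b : ℝ} (ha : 0 < a) (hb : 0 < b) :
    b⁻¹ ≤ a ^ 2 * ((a ^ 3)⁻¹ + (b ^ 3)⁻¹) := by
  have hsplit : a ^ 2 * ((a ^ 3)⁻¹ + (b ^ 3)⁻¹) = a⁻¹ + a ^ 2 * (b ^ 3)⁻¹ := by
    field_simp
  rw [hsplit]
  rcases le_total a b with h | h
  · have h1 : b⁻¹ ≤ a⁻¹ := by gcongr
    have h2 : 0 < a ^ 2 * (b ^ 3)⁻¹ := by positivity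
    linarith
  · have h1 : b⁻¹ = b ^ 2 * (b ^ 3)⁻¹ := by field_simp
    have h2 : b ^ 2 * (b ^ 3)⁻¹ ≤ a ^ 2 * (b ^ 3)⁻¹ := by gcongr
    have h3 : 0 < a⁻¹ := by positivity
    linarith

lemma inv_sqrt_norm_pow_three_le {k : EuclideanSpace ℝ (Fin 3)} (hk : kperp k ≠ 0) :
    (Real.sqrt ‖k‖ ^ 3)⁻¹ ≤ (Real.sqrt ‖k‖ * ‖kperp k‖)⁻¹ := by
  have hk' : 0 < ‖kperp k‖ := norm_pos_iff.mpr hk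
  have hs : 0 < Real.sqrt ‖k‖ := Real.sqrt_pos.mpr (hk'.trans_le (norm_kperp_le k))
  rw [pow_succ', Real.sq_sqrt (norm_nonneg k)]
  gcongr
  exact norm_kperp_le k

/-- The kernel estimate without the coupling constant. -/
lemma norm_phase_smul_eps_sub_le {k p : EuclideanSpace ℝ (Fin 3)} (hk : kperp k ≠ 0)
    (hp : kperp p ≠ 0) (x : EuclideanSpace ℝ (Fin 3)) (l : Fin 2) :
    ‖((((Real.sqrt ‖k‖)⁻¹ : ℝ) : ℂ) * phase x k) • complexify (eps k l) -
      ((((Real.sqrt ‖p‖)⁻¹ : ℝ) : ℂ) * phase x p) • complexify (eps p l)‖ ≤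
      6 * (‖x‖ * ‖k‖ * ‖k - p‖ *
        ((Real.sqrt ‖k‖ * ‖kperp k‖)⁻¹ + (Real.sqrt ‖p‖ * ‖kperp p‖)⁻¹)) := by
  have hk' : 0 < ‖kperp k‖ := norm_pos_iff.mpr hk
  have hp' : 0 < ‖kperp p‖ := norm_pos_iff.mpr hp
  have hSk := inv_sqrt_norm_pow_three_le hk
  have hSp := inv_sqrt_norm_pow_three_le hp
  have hka : Real.sqrt ‖k‖ ^ 2 = ‖k‖ := Real.sq_sqrt (norm_nonneg k)
  have hpb : Real.sqrt ‖p‖ ^ 2 = ‖p‖ := Real.sq_sqrt (norm_nonneg p)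
  have ha : 0 < Real.sqrt ‖k‖ := Real.sqrt_pos.mpr (hk'.trans_le (norm_kperp_le k))
  have hb : 0 < Real.sqrt ‖p‖ := Real.sqrt_pos.mpr (hp'.trans_le (norm_kperp_le p))
  have hweight := inv_le_sq_mul_add ha hb
  have hroot := abs_inv_sub_inv_le ha hb
  rw [hka] at hweight
  rw [hka, hpb] at hroot
  set a := Real.sqrt ‖k‖
  set b := Real.sqrt ‖p‖
  set S := (a * ‖kperp k‖)⁻¹ + (b * ‖kperp p‖)⁻¹
  have hpS : (b * ‖kperp p‖)⁻¹ ≤ S := le_add_of_nonneg_left (by positivity)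
  have hS0 : 0 ≤ S := by positivity
  have hcube : (a ^ 3)⁻¹ + (b ^ 3)⁻¹ ≤ S := add_le_add hSk hSp
  have hdecomp : (((a⁻¹ : ℝ) : ℂ) * phase x k) • complexify (eps k l) -
      (((b⁻¹ : ℝ) : ℂ) * phase x p) • complexify (eps p l) =
      (((b⁻¹ : ℝ) : ℂ) * (phase x k - phase x p)) • complexify (eps p l) +
      (((a⁻¹ - b⁻¹ : ℝ) : ℂ) * phase x k) • complexify (eps k l) +
      (((b⁻¹ : ℝ) : ℂ) * phase x k) • complexify (eps k l - eps p l) := by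
    rw [complexify_sub, Complex.ofReal_sub]
    module
  have hphase : ‖(((b⁻¹ : ℝ) : ℂ) * (phase x k - phase x p)) • complexify (eps p l)‖ ≤
      ‖x‖ * ‖k‖ * ‖k - p‖ * S := by
    rw [norm_smul, norm_mul, Complex.norm_real, norm_complexify, Real.norm_eq_abs,
      abs_of_pos (inv_pos.mpr hb)]
    calc b⁻¹ * ‖phase x k - phase x p‖ * ‖eps p l‖
        ≤ (‖k‖ * S) * (‖x‖ * ‖k - p‖) * 1 := by
          gcongr
          · exact hweight.trans (mul_le_mul_of_nonneg_left hcube (norm_nonneg k))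
          · exact norm_phase_sub_le x k p
          · exact norm_eps_le_one hp l
      _ = _ := by ring
  have hsqrt : ‖(((a⁻¹ - b⁻¹ : ℝ) : ℂ) * phase x k) • complexify (eps k l)‖ ≤
      ‖x‖ * ‖k‖ * ‖k - p‖ * S := by
    rw [norm_smul, norm_mul, Complex.norm_real, norm_complexify, Real.norm_eq_abs]
    calc |a⁻¹ - b⁻¹| * ‖phase x k‖ * ‖eps k l‖
        ≤ (‖k - p‖ * S) * (‖x‖ * ‖k‖) * 1 := by
          gcongr
          · refine hroot.trans ?_
            gcongr
            exact abs_norm_sub_norm_le k p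
          · exact norm_phase_le x k
          · exact norm_eps_le_one hk l
      _ = _ := by ring
  have heps : ‖(((b⁻¹ : ℝ) : ℂ) * phase x k) • complexify (eps k l - eps p l)‖ ≤
      4 * (‖x‖ * ‖k‖ * ‖k - p‖ * S) := by
    rw [norm_smul, norm_mul, Complex.norm_real, norm_complexify, Real.norm_eq_abs,
      abs_of_pos (inv_pos.mpr hb)]
    calc b⁻¹ * ‖phase x k‖ * ‖eps k l - eps p l‖
        ≤ b⁻¹ * (‖x‖ * ‖k‖) * (4 * ‖k - p‖ / ‖kperp p‖) := by
          gcongr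
          · exact norm_phase_le x k
          · exact norm_eps_sub_le hk hp l
      _ = 4 * (‖x‖ * ‖k‖ * ‖k - p‖ * (b * ‖kperp p‖)⁻¹) := by
          rw [mul_inv]
          ring
      _ ≤ _ := by gcongr
  rw [hdecomp]
  refine norm_add₃_le.trans ?_
  linarith

/-- The elementary kernel estimate on `G̃_x(k,λ) − G̃_x(p,λ)` yielding the photon derivative
bound: the constant depends only on `e`. -/
theorem Gtilde_diff_kernel_bound (e : ℝ) :
    ∃ C > 0, ∀ Λ > 0, ∀ x k p : EuclideanSpace ℝ (Fin 3), ∀ l : Fin 2,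
      0 < ‖k‖ → ‖k‖ < Λ → 0 < ‖p‖ → ‖p‖ < Λ → kperp k ≠ 0 → kperp p ≠ 0 →
      ‖Gtilde e Λ x k l - Gtilde e Λ x p l‖ ≤
        C * (1 + ‖x‖) * ‖k‖ * ‖k - p‖ *
          ((Real.sqrt ‖k‖ * ‖kperp k‖)⁻¹ + (Real.sqrt ‖p‖ * ‖kperp p‖)⁻¹) := by
  refine ⟨6 * |e / (2 * Real.pi)| + 1, by positivity, ?_⟩
  intro Λ _ x k p l _ hkΛ _ hpΛ hk hp
  rw [Gtilde_eq hkΛ.le, Gtilde_eq hpΛ.le, ← smul_sub, norm_smul, Complex.norm_real,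
    Real.norm_eq_abs, abs_neg]
  calc |e / (2 * Real.pi)| * _
      ≤ |e / (2 * Real.pi)| * (6 * (‖x‖ * ‖k‖ * ‖k - p‖ *
          ((Real.sqrt ‖k‖ * ‖kperp k‖)⁻¹ + (Real.sqrt ‖p‖ * ‖kperp p‖)⁻¹))) := by
        gcongr
        exact norm_phase_smul_eps_sub_le hk hp x l
    _ = 6 * |e / (2 * Real.pi)| * ‖x‖ * ‖k‖ * ‖k - p‖ *
          ((Real.sqrt ‖k‖ * ‖kperp k‖)⁻¹ + (Real.sqrt ‖p‖ * ‖kperp p‖)⁻¹) := by ring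
    _ ≤ _ := by
        gcongr <;> linarith

end
end
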